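/- Let (A,H,D,J) be a real structure datum: π : A → End(H) a representation of a complex *-algebra A, D a linear operator on H, J an anti-linear bijection with J² = ε·id, satisfying for all a,b ∈ A the order-zero condition [π(a), Jπ(b)J⁻¹] = 0, the order-one condition [D,π(a)] J π(b) J⁻¹ = J π(b) J⁻¹ [D,π(a)], and J D = ε′ D J (ε, ε′ ∈ {+1,−1}). Let k̃ ∈ A be invertible, k = π(k̃), k′ = J k J⁻¹, D_k = k′ D k′, ν = k⁻¹k′, ν̄(φ) = ν∘φ∘ν⁻¹, and ν̂(a) = k̃⁻¹ a k̃. Then (A, H, D_k) admits J as a ν-twisted real structure with the same signs: π∘ν̂ = ν̄∘π, [D_k,π(a)] J ν̄²(π(b)) J⁻¹ = J π(b) J⁻¹ [D_k,π(a)], D_k J ν = ε′ ν J D_k, and ν J ν = J. Moreover, if γ is a linear operator with γ² = id, [γ,π(a)] = 0 for all a ∈ A, γ D = −D γ and γ J = ε″ J γ (ε″ ∈ {+1,−1}), then γ D_k = −D_k γ and γ ν = ν γ. -/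

import Mathlib

/-- Conjugation of a linear endomorphism by an anti-linear bijection `J`:
`φ ↦ J ∘ φ ∘ J⁻¹`, which is again a linear endomorphism. -/
noncomputable def conjAL {H : Type*} [AddCommGroup H] [Module ℂ H]
    (J : H ≃ₗ⋆[ℂ] H) (φ : Module.End ℂ H) : Module.End ℂ H where
  toFun h := J (φ (J.symm h))
  map_add' x y := by simp
  map_smul' c x := by
    simp only [LinearEquiv.map_smulₛₗ, LinearMap.map_smulₛₗ, RingHom.id_apply,
      starRingEnd_apply, star_star, LinearMap.map_smul]

theorem conjAL_apply {H : Type*} [AddCommGroup H] [Module ℂ H]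
    (J : H ≃ₗ⋆[ℂ] H) (φ : Module.End ℂ H) (h : H) : conjAL J φ h = J (φ (J.symm h)) := rfl

theorem conjAL_apply_map {H : Type*} [AddCommGroup H] [Module ℂ H]
    (J : H ≃ₗ⋆[ℂ] H) (φ : Module.End ℂ H) (h : H) : conjAL J φ (J h) = J (φ h) := by
  simp [conjAL_apply]

theorem conjAL_mul {H : Type*} [AddCommGroup H] [Module ℂ H]
    (J : H ≃ₗ⋆[ℂ] H) (φ ψ : Module.End ℂ H) :
    conjAL J (φ * ψ) = conjAL J φ * conjAL J ψ := by
  ext h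
  simp [conjAL_apply]

theorem conjAL_one {H : Type*} [AddCommGroup H] [Module ℂ H] (J : H ≃ₗ⋆[ℂ] H) :
    conjAL J 1 = 1 := by
  ext h
  simp [conjAL_apply]

/-- If `J²` is a scalar, conjugating twice by `J` is trivial. -/
theorem map_conjAL_apply {H : Type*} [AddCommGroup H] [Module ℂ H]
    (J : H ≃ₗ⋆[ℂ] H) {ε : ℂ} (hJ2 : ∀ h : H, J (J h) = ε • h) (φ : Module.End ℂ H) (h : H) :
    J (conjAL J φ h) = φ (J h) := by
  obtain ⟨x, rfl⟩ := J.surjective h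
  rw [conjAL_apply_map, hJ2, hJ2, map_smul]

/-- A linear map commuting with `φ`, and with `J` up to a sign, commutes with `J ∘ φ ∘ J⁻¹`. -/
theorem Commute.conjAL_right {H : Type*} [AddCommGroup H] [Module ℂ H]
    {J : H ≃ₗ⋆[ℂ] H} {γ φ : Module.End ℂ H} {ε : ℂ} (hε : ε = 1 ∨ ε = -1)
    (hγ : Commute γ φ) (hJ : ∀ h : H, γ (J h) = ε • J (γ h)) : Commute γ (conjAL J φ) := by
  refine LinearMap.ext fun h => ?_
  obtain ⟨x, rfl⟩ := J.surjective h
  have hx : γ (φ x) = φ (γ x) := LinearMap.congr_fun hγ.eq x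
  rcases hε with rfl | rfl <;> simp [conjAL_apply_map, hJ, hx]

/-- if `(A,H,D,J)` is a real structure datum (order-zero, order-one,
`J² = ε`, `JD = ε′DJ`), then for invertible `k̃ ∈ A`, `k = π(k̃)`, `k′ = J k J⁻¹`,
`D_k = k′ D k′`, `ν = k⁻¹k′`, the triple `(A,H,D_k)` admits `J` as a `ν`-twisted real
structure with the same signs, and any compatible grading `γ` anticommutes with `D_k`
and commutes with `ν`. -/
theorem conformal_rescaling_twisted_real
    {A H : Type*} [Ring A] [Algebra ℂ A] [StarRing A]
    [AddCommGroup H] [Module ℂ H]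
    (π : A →ₐ[ℂ] Module.End ℂ H) (D : Module.End ℂ H) (J : H ≃ₗ⋆[ℂ] H)
    (ε ε' : ℂ) (hε : ε = 1 ∨ ε = -1) (hε' : ε' = 1 ∨ ε' = -1)
    (hJ2 : ∀ h : H, J (J h) = ε • h)
    (hzero : ∀ a b : A, π a * conjAL J (π b) = conjAL J (π b) * π a)
    (hone : ∀ a b : A, (D * π a - π a * D) * conjAL J (π b)
        = conjAL J (π b) * (D * π a - π a * D))
    (hJD : ∀ h : H, J (D h) = ε' • D (J h))
    (kt : Aˣ)
    (k' Dk ν νinv : Module.End ℂ H)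
    (hk' : k' = conjAL J (π (kt : A)))
    (hDk : Dk = k' * D * k')
    (hν : ν = π (↑kt⁻¹ : A) * conjAL J (π (kt : A)))
    (hνinv : νinv = conjAL J (π (↑kt⁻¹ : A)) * π (kt : A)) :
    (∀ a : A, π ((↑kt⁻¹ : A) * a * (kt : A)) = ν * π a * νinv) ∧
    (∀ a b : A, (Dk * π a - π a * Dk) * conjAL J (ν * (ν * π b * νinv) * νinv)
        = conjAL J (π b) * (Dk * π a - π a * Dk)) ∧
    (∀ h : H, Dk (J (ν h)) = ε' • ν (J (Dk h))) ∧
    (∀ h : H, ν (J (ν h)) = J h) ∧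
    (∀ (γ : Module.End ℂ H) (ε'' : ℂ), (ε'' = 1 ∨ ε'' = -1) →
      γ * γ = 1 → (∀ a : A, γ * π a = π a * γ) → γ * D = -(D * γ) →
      (∀ h : H, γ (J h) = ε'' • J (γ h)) →
      γ * Dk = -(Dk * γ) ∧ γ * ν = ν * γ) := by
  set K := π (kt : A) with hK
  set L := π (↑kt⁻¹ : A) with hL
  set L' := conjAL J L with hL'
  have hKL : K * L = 1 := by rw [hK, hL, ← map_mul, Units.mul_inv, map_one]
  have hLK : L * K = 1 := by rw [hK, hL, ← map_mul, Units.inv_mul, map_one]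
  rw [← hk'] at hν
  have hKL' : k' * L' = 1 := by rw [hk', hL', ← conjAL_mul, hKL, conjAL_one]
  have hcK (a : A) : π a * k' = k' * π a := hk' ▸ hzero a kt
  have hconj (a : A) : ν * π a * νinv = π ((↑kt⁻¹ : A) * a * (kt : A)) := by
    calc ν * π a * νinv = L * (k' * π a) * L' * K := by simp only [hν, hνinv, mul_assoc]
      _ = L * π a * (k' * L') * K := by rw [← hcK]; simp only [mul_assoc]
      _ = π ((↑kt⁻¹ : A) * a * (kt : A)) := by rw [hKL', mul_one, map_mul, map_mul]
  have hJk (h : H) : J (k' h) = K (J h) := hk' ▸ map_conjAL_apply J hJ2 K h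
  have hkJL (h : H) : k' (J (L h)) = J h := by
    rw [← conjAL_apply_map J L h]
    exact LinearMap.congr_fun hKL' (J h)
  have hLkK (h : H) : L (k' (K h)) = k' h := by
    have h1 : k' (K h) = K (k' h) := (LinearMap.congr_fun (hcK kt) h).symm
    rw [h1]
    exact LinearMap.congr_fun hLK (k' h)
  refine ⟨fun a => (hconj a).symm, fun a b => ?_, fun h => ?_, fun h => ?_, ?_⟩
  · have hcomm : Dk * π a - π a * Dk = k' * (D * π a - π a * D) * k' := by
      have h1 : Dk * π a = k' * (D * π a) * k' := by
        rw [hDk, mul_assoc _ k', ← hcK]; simp only [mul_assoc]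
      have h2 : π a * Dk = k' * (π a * D) * k' := by
        rw [hDk, ← mul_assoc, ← mul_assoc, hcK]; simp only [mul_assoc]
      rw [h1, h2, mul_sub, sub_mul]
    have hT := hone a ((↑kt⁻¹ : A) * b * kt * kt)
    have hTk : (D * π a - π a * D) * k' = k' * (D * π a - π a * D) := hk' ▸ hone a kt
    simp only [map_mul, conjAL_mul, ← hK, ← hL, ← hL', ← hk'] at hT
    set T := D * π a - π a * D
    rw [hconj, hconj, hcomm]
    simp only [map_mul, conjAL_mul, ← hK, ← hL, ← hL', ← hk']
    set B := conjAL J (π b)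
    calc k' * T * k' * (L' * (L' * B * k') * k')
        = k' * T * (k' * L') * (L' * B * k' * k') := by simp only [mul_assoc]
      _ = k' * (T * (L' * B * k' * k')) := by rw [hKL', mul_one, mul_assoc]
      _ = (k' * L') * B * k' * (k' * T) := by rw [hT]; simp only [mul_assoc]
      _ = B * (k' * T * k') := by rw [hKL', one_mul, mul_assoc k' T, hTk, mul_assoc]
  · have hJD' : ε' • J (D (k' h)) = D (J (k' h)) := by
      rw [hJD, smul_smul]
      rcases hε' with rfl | rfl <;> simp
    simp only [hν, hDk, Module.End.mul_apply]
    rw [hkJL, hJk (D (k' h)), hLkK, ← map_smul, hJD']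
  · simp only [hν, Module.End.mul_apply]
    rw [hkJL, hJk]
    exact LinearMap.congr_fun hLK (J h)
  · intro γ ε'' hε'' _ hγπ hγD hγJ
    have hγk : γ * k' = k' * γ := hk' ▸ (Commute.conjAL_right hε'' (hγπ kt) hγJ).eq
    constructor
    · calc γ * Dk = (γ * k') * D * k' := by simp only [hDk, mul_assoc]
        _ = k' * (γ * D) * k' := by rw [hγk]; simp only [mul_assoc]
        _ = -(k' * D * (γ * k')) := by rw [hγD]; simp only [mul_neg, neg_mul, mul_assoc]
        _ = -(Dk * γ) := by rw [hγk, hDk]; simp only [mul_assoc]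
    · rw [hν]
      exact (Commute.mul_right (hγπ _) hγk).eq
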